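/- Let m ≥ 1 be an integer and let Γ ⊂ P^n be a finite scheme of degree d ≥ 4n² + 6n + 1 + 2(n+1)m contained in a rational normal curve C of degree n, over an algebraically closed field of characteristic 0. If A ⊂ P^n \ C is a finite set with |A| ≤ m such that Γ ∪ A is in linearly general position, then reg(Γ ∪ A) = reg(Γ) = ⌈(d−1)/n⌉ + 1. -/

import Mathlib

open MvPolynomial Filter
open scoped Classical

attribute [local instance] MvPolynomial.gradedAlgebra

noncomputable section

variable {K : Type} [Field K] {n : ℕ}

/-- The Hilbert function, in degree `m`, of the quotient of the homogeneous
coordinate ring of `ℙ^n_K` by the ideal `I`. -/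
def hilbF (I : Ideal (MvPolynomial (Fin (n+1)) K)) (m : ℕ) : ℕ :=
  Module.finrank K
    ((MvPolynomial.homogeneousSubmodule (Fin (n+1)) K m).map
      (Ideal.Quotient.mkₐ K I).toLinearMap)

/-- The irrelevant maximal ideal `(x_0, …, x_n)`. -/
def irrelevantIdeal (K : Type) [Field K] (n : ℕ) : Ideal (MvPolynomial (Fin (n+1)) K) :=
  Ideal.span (Set.range MvPolynomial.X)

/-- Saturation of a homogeneous ideal with respect to the irrelevant ideal. -/
def saturate (I : Ideal (MvPolynomial (Fin (n+1)) K)) : Ideal (MvPolynomial (Fin (n+1)) K) :=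
  ⨆ k : ℕ, Submodule.colon I ((irrelevantIdeal K n ^ k : Ideal (MvPolynomial (Fin (n+1)) K)) : Submodule (MvPolynomial (Fin (n+1)) K) (MvPolynomial (Fin (n+1)) K))

/-- `I` is the (saturated, homogeneous) ideal of a nonempty finite closed subscheme of
`ℙ^n`, i.e. its Hilbert function is eventually a positive constant. -/
structure IsFiniteSubscheme (I : Ideal (MvPolynomial (Fin (n+1)) K)) : Prop where
  homog : Ideal.IsHomogeneous (MvPolynomial.homogeneousSubmodule (Fin (n+1)) K) I
  saturated : saturate I = I
  finite : ∃ d : ℕ, 0 < d ∧ ∀ᶠ m : ℕ in atTop, hilbF I m = d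

/-- The degree (length) of the finite scheme with ideal `I` : the eventual value of
its Hilbert function. -/
def schemeDeg (I : Ideal (MvPolynomial (Fin (n+1)) K)) : ℕ :=
  if h : ∃ d : ℕ, ∀ᶠ m : ℕ in atTop, hilbF I m = d then h.choose else 0

/-- The Castelnuovo–Mumford regularity of the finite scheme with ideal `I` : the least
`p ≥ 1` such that the scheme is `(p-1)`-normal (for a finite scheme, `p`-regularity is
equivalent to `(p-1)`-normality). -/
def schemeReg (I : Ideal (MvPolynomial (Fin (n+1)) K)) : ℕ :=
  sInf {p : ℕ | 1 ≤ p ∧ ∀ m : ℕ, p - 1 ≤ m → hilbF I m = schemeDeg I}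

/-- `h¹(ℙ^n, I_Γ(q))` for a finite scheme `Γ` and `q ≥ 0`: the failure of `q`-normality,
`deg Γ - h_Γ(q)`. -/
def h1F (I : Ideal (MvPolynomial (Fin (n+1)) K)) (q : ℕ) : ℕ :=
  schemeDeg I - hilbF I q

/-- `J` is the ideal of a `t`-dimensional linear subspace of `ℙ^n`: it is generated by a
space of linear forms of codimension... i.e. of `K`-dimension `n - t`. -/
def IsLinearSubspace (J : Ideal (MvPolynomial (Fin (n+1)) K)) (t : ℕ) : Prop :=
  ∃ W : Submodule K (MvPolynomial (Fin (n+1)) K),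
    W ≤ MvPolynomial.homogeneousSubmodule (Fin (n+1)) K 1 ∧
    Module.finrank K W + t = n ∧
    J = Ideal.span (W : Set (MvPolynomial (Fin (n+1)) K))

/-- The ideal of the scheme-theoretic intersection (defined by the sum of the ideal
sheaves): the saturation of `I + J`. -/
def interIdeal (I J : Ideal (MvPolynomial (Fin (n+1)) K)) : Ideal (MvPolynomial (Fin (n+1)) K) :=
  saturate (I ⊔ J)

/-- The residual scheme `Γ : V`, where `V` is the hypersurface `{f = 0}`, is defined by
the colon ideal `(I_Γ : f)`. -/
def residualIdeal (I : Ideal (MvPolynomial (Fin (n+1)) K)) (f : MvPolynomial (Fin (n+1)) K) :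
    Ideal (MvPolynomial (Fin (n+1)) K) :=
  Submodule.colon I (Ideal.span {f})

/-- `Γ` admits a `(t+2)`-secant `t`-plane. -/
def HasSecantPlane (I : Ideal (MvPolynomial (Fin (n+1)) K)) (t : ℕ) : Prop :=
  ∃ J : Ideal (MvPolynomial (Fin (n+1)) K),
    IsLinearSubspace J t ∧ t + 2 ≤ schemeDeg (interIdeal I J)

/-- `t(Γ)`: the smallest `t` such that `Γ` admits a `(t+2)`-secant `t`-plane. -/
def tInv (I : Ideal (MvPolynomial (Fin (n+1)) K)) : ℕ :=
  sInf {t : ℕ | HasSecantPlane I t}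

/-- `Γ` is in linearly general position if `t(Γ) = n`. -/
def InLinGenPos (I : Ideal (MvPolynomial (Fin (n+1)) K)) : Prop :=
  tInv I = n

/-- `Γ ⊆ ℙ^n` is nondegenerate: `I(Γ)` contains no nonzero linear form. -/
def NondegenerateScheme (I : Ideal (MvPolynomial (Fin (n+1)) K)) : Prop :=
  Submodule.restrictScalars K I ⊓ MvPolynomial.homogeneousSubmodule (Fin (n+1)) K 1 = ⊥

/-- The (projective) dimension of the linear span `⟨Γ⟩` of the scheme with ideal `I`:
`n` minus the number of independent linear forms in `I`. -/
def spanDim (I : Ideal (MvPolynomial (Fin (n+1)) K)) : ℕ :=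
  n - Module.finrank K
    ↥(Submodule.restrictScalars K I ⊓ MvPolynomial.homogeneousSubmodule (Fin (n+1)) K 1)

/-- `Γ ∩ Λ` is nondegenerate as a subscheme of the `t`-plane `Λ`: it is contained in no
`(t-1)`-dimensional linear subspace of `Λ`. -/
def NondegenerateIn (I Λ : Ideal (MvPolynomial (Fin (n+1)) K)) (t : ℕ) : Prop :=
  ∀ J : Ideal (MvPolynomial (Fin (n+1)) K),
    IsLinearSubspace J (t - 1) → Λ ≤ J → ¬ J ≤ interIdeal I Λ

/-- `Γ ∩ Λ` is in linearly general position as a subscheme of the `t`-plane `Λ`: it has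
no `(s+2)`-secant `s`-plane inside `Λ` for any `s < t`. -/
def InLinGenPosIn (I Λ : Ideal (MvPolynomial (Fin (n+1)) K)) (t : ℕ) : Prop :=
  ∀ s : ℕ, s < t → ∀ J : Ideal (MvPolynomial (Fin (n+1)) K),
    IsLinearSubspace J s → Λ ≤ J → schemeDeg (interIdeal I J) ≤ s + 1

/-- `J` is the (saturated) homogeneous ideal of a rational normal curve of degree `t`
in `ℙ^n` : the curve is the image of `ℙ^1` under a parametrization by a basis-spanning
family of binary forms of degree `t`, and `J` is the vanishing ideal of (the affine cone
over) this image. -/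
def IsRNC (t : ℕ) (J : Ideal (MvPolynomial (Fin (n+1)) K)) : Prop :=
  ∃ p : Fin (n+1) → MvPolynomial (Fin 2) K,
    (∀ i, (p i).IsHomogeneous t) ∧
    Submodule.span K (Set.range p) = MvPolynomial.homogeneousSubmodule (Fin 2) K t ∧
    J = ⨅ x : Fin 2 → K,
      RingHom.ker (MvPolynomial.eval (fun i => MvPolynomial.eval x (p i)) :
        MvPolynomial (Fin (n+1)) K →+* K)

/-- `ρ(Γ)`: the maximal length of the intersection of `Γ` with a rational normal curve
(of degree `n`) in `ℙ^n`. -/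
def rhoInv (I : Ideal (MvPolynomial (Fin (n+1)) K)) : ℕ :=
  sSup {e : ℕ | ∃ J : Ideal (MvPolynomial (Fin (n+1)) K),
    IsRNC n J ∧ e = schemeDeg (interIdeal I J)}

/-- The (saturated homogeneous) vanishing ideal of a point of `ℙ^n`. -/
def pointIdeal (P : Projectivization K (Fin (n+1) → K)) : Ideal (MvPolynomial (Fin (n+1)) K) :=
  ⨅ c : K, RingHom.ker
    (MvPolynomial.eval (c • P.rep) : MvPolynomial (Fin (n+1)) K →+* K)

/-- The vanishing ideal of a finite set of points of `ℙ^n`. -/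
def idealOfFinset (S : Finset (Projectivization K (Fin (n+1) → K))) :
    Ideal (MvPolynomial (Fin (n+1)) K) :=
  ⨅ P ∈ S, pointIdeal P

/-- A finite set of points of `ℙ^n` is in uniform position if every subset `Y` has
Hilbert function `h_Y(ℓ) = min {|Y|, h_Γ(ℓ)}`. -/
def UniformPosition (S : Finset (Projectivization K (Fin (n+1) → K))) : Prop :=
  ∀ Y ⊆ S, ∀ ℓ : ℕ, hilbF (idealOfFinset Y) ℓ = min Y.card (hilbF (idealOfFinset S) ℓ)


end

/-- The substitution `X_i ↦ X_i T`, recording degrees in the auxiliary variable `T`. -/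
noncomputable def scaleVars (σ K : Type*) [Field K] :
    MvPolynomial σ K →ₐ[K] Polynomial (MvPolynomial σ K) :=
  MvPolynomial.aeval fun i => Polynomial.C (MvPolynomial.X i) * Polynomial.X

lemma scaleVars_of_isHomogeneous {σ K : Type*} [Field K] {f : MvPolynomial σ K} {e : ℕ}
    (hf : f.IsHomogeneous e) :
    scaleVars σ K f = Polynomial.C f * Polynomial.X ^ e := by
  have h1 : ∀ d ∈ f.support, scaleVars σ K (monomial d (coeff d f)) =
      Polynomial.C (monomial d (coeff d f)) * Polynomial.X ^ e := by
    intro d hd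
    have hde := hf.degree_eq_sum_deg_support hd
    rw [scaleVars, aeval_monomial, Finsupp.prod]
    simp only [mul_pow, Finset.prod_mul_distrib, Finset.prod_pow_eq_pow_sum]
    rw [hde, ← mul_assoc]
    congr 1
    rw [monomial_eq, Finsupp.prod, map_mul, map_prod]
    simp only [map_pow]
    rfl
  conv_lhs => rw [f.as_sum]
  conv_rhs => rw [f.as_sum]
  rw [map_sum, map_sum, Finset.sum_mul]
  exact Finset.sum_congr rfl h1

lemma coeff_scaleVars {σ K : Type*} [Field K] (f : MvPolynomial σ K) (a : ℕ) :
    (scaleVars σ K f).coeff a = homogeneousComponent a f := by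
  conv_lhs => rw [← sum_homogeneousComponent f, map_sum]
  rw [Polynomial.finsetSum_coeff]
  simp only [scaleVars_of_isHomogeneous (homogeneousComponent_isHomogeneous _ f),
    Polynomial.coeff_C_mul_X_pow]
  rw [Finset.sum_ite_eq (Finset.range (f.totalDegree + 1)) a]
  split_ifs with h
  · rfl
  · rw [homogeneousComponent_eq_zero]
    simpa using h

lemma eval_one_scaleVars {σ K : Type*} [Field K] (f : MvPolynomial σ K) :
    (scaleVars σ K f).eval 1 = f := by
  have h : ((Polynomial.aeval (1 : MvPolynomial σ K)).restrictScalars K).comp (scaleVars σ K)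
      = AlgHom.id K _ := by
    ext i
    simp [scaleVars]
  exact DFunLike.congr_fun h f

/-- A factor of a nonzero homogeneous polynomial is homogeneous. -/
lemma exists_isHomogeneous_of_mul {σ K : Type*} [Field K] {f g : MvPolynomial σ K} {e : ℕ}
    (h : (f * g).IsHomogeneous e) (h0 : f * g ≠ 0) :
    ∃ a, f.IsHomogeneous a := by
  have hf : f ≠ 0 := left_ne_zero_of_mul h0
  have hg : g ≠ 0 := right_ne_zero_of_mul h0
  have hs : ∀ f : MvPolynomial σ K, f ≠ 0 → scaleVars σ K f ≠ 0 := by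
    intro f hf h
    apply hf
    rw [← eval_one_scaleVars f, h, Polynomial.eval_zero]
  have hmul := scaleVars_of_isHomogeneous h
  rw [map_mul] at hmul
  have hd := congrArg Polynomial.natDegree hmul
  have ht := congrArg Polynomial.natTrailingDegree hmul
  rw [Polynomial.natDegree_mul (hs f hf) (hs g hg), Polynomial.natDegree_C_mul_X_pow _ _ h0] at hd
  rw [Polynomial.natTrailingDegree_mul (hs f hf) (hs g hg),
    Polynomial.C_mul_X_pow_eq_monomial, Polynomial.natTrailingDegree_monomial h0] at ht
  have h1 := (scaleVars σ K f).natTrailingDegree_le_natDegree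
  have h2 := (scaleVars σ K g).natTrailingDegree_le_natDegree
  have h3 : (scaleVars σ K f).natTrailingDegree = (scaleVars σ K f).natDegree := by omega
  refine ⟨(scaleVars σ K f).natDegree, ?_⟩
  have h4 : scaleVars σ K f = Polynomial.C (homogeneousComponent (scaleVars σ K f).natDegree f) *
      Polynomial.X ^ (scaleVars σ K f).natDegree := by
    ext1 j
    rw [Polynomial.coeff_C_mul_X_pow]
    split_ifs with hj
    · rw [hj, coeff_scaleVars]
    · rcases lt_or_gt_of_ne hj with hj | hj
      · exact Polynomial.coeff_eq_zero_of_lt_natTrailingDegree (h3 ▸ hj)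
      · exact Polynomial.coeff_eq_zero_of_natDegree_lt hj
  have h5 := congrArg (Polynomial.eval 1) h4
  rw [eval_one_scaleVars] at h5
  simp only [Polynomial.eval_mul, Polynomial.eval_C, Polynomial.eval_pow, Polynomial.eval_X,
    one_pow, mul_one] at h5
  rw [h5]
  convert homogeneousComponent_isHomogeneous (scaleVars σ K f).natDegree f using 1
  rw [← h5]

/-- The binary forms of degree `e` form a space of dimension `e + 1`. -/
lemma finrank_binaryForms (K : Type*) [Field K] (e : ℕ) :
    Module.finrank K (homogeneousSubmodule (Fin 2) K e) = e + 1 := by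
  have h : homogeneousSubmodule (Fin 2) K e =
      restrictSupport K {d : Fin 2 →₀ ℕ | d.degree = e} :=
    homogeneousSubmodule_eq_finsupp_supported _ _ _
  rw [h, Module.finrank_eq_nat_card_basis (basisRestrictSupport K _)]
  have e1 : {d : Fin 2 →₀ ℕ | d.degree = e} ≃ Finset.HasAntidiagonal.antidiagonal e :=
    { toFun := fun d => ⟨(d.1 0, d.1 1), by
        have := d.2
        simpa [Finsupp.degree_eq_sum] using this⟩
      invFun := fun x => ⟨Finsupp.equivFunOnFinite.symm ![x.1.1, x.1.2], by
        have := Finset.HasAntidiagonal.mem_antidiagonal.1 x.2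
        simpa [Finsupp.degree_eq_sum, Finset.HasAntidiagonal.mem_antidiagonal] using this⟩
      left_inv := by
        intro d
        ext i
        fin_cases i <;> simp
      right_inv := by
        intro x
        simp }
  rw [Nat.card_congr e1, Nat.card_eq_fintype_card, Fintype.card_coe,
    Finset.Nat.card_antidiagonal]

instance finite_homogeneousSubmodule (σ K : Type*) [Finite σ] [Field K] (e : ℕ) :
    Module.Finite K (homogeneousSubmodule σ K e) :=
  Module.Finite.iff_fg.2 (homogeneousSubmodule_fg σ K e)


/-- Coprime binary forms of positive degrees `a + 1` and `b + 1` generate all forms of degree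
`a + b + 1`. -/
lemma exists_combination_of_isRelPrime_aux {K : Type*} [Field K] {f g : MvPolynomial (Fin 2) K}
    {a b : ℕ} (hf : f.IsHomogeneous (a + 1)) (hg : g.IsHomogeneous (b + 1))
    (hg0 : g ≠ 0) (hrel : IsRelPrime f g) {w : MvPolynomial (Fin 2) K}
    (hw : w.IsHomogeneous (a + b + 1)) :
    ∃ u v : MvPolynomial (Fin 2) K, u.IsHomogeneous b ∧ v.IsHomogeneous a ∧
      w = f * u + g * v := by
  let ψ : (homogeneousSubmodule (Fin 2) K b × homogeneousSubmodule (Fin 2) K a) →ₗ[K]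
      homogeneousSubmodule (Fin 2) K (a + b + 1) :=
    { toFun := fun x => ⟨f * x.1.1 + g * x.2.1, by
        refine IsHomogeneous.add ?_ ?_
        · have := hf.mul x.1.2
          rwa [show a + 1 + b = a + b + 1 by ring] at this
        · have := hg.mul x.2.2
          rwa [show b + 1 + a = a + b + 1 by ring] at this⟩
      map_add' := by
        intro x y
        ext1
        simp only [Prod.fst_add, Prod.snd_add, Submodule.coe_add]
        ring
      map_smul' := by
        intro c x
        ext1
        simp only [Prod.smul_fst, Prod.smul_snd, Submodule.coe_smul, RingHom.id_apply, smul_add,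
          mul_smul_comm] }
  have hinj : Function.Injective ψ := by
    rw [← LinearMap.ker_eq_bot, LinearMap.ker_eq_bot']
    rintro ⟨u, v⟩ huv
    have h1 : f * u.1 + g * v.1 = 0 := congrArg Subtype.val huv
    have h2 : g ∣ f * u.1 := ⟨-v.1, by linear_combination h1⟩
    have h3 : g ∣ u.1 := hrel.symm.dvd_of_dvd_mul_left h2
    have hu : u.1 = 0 := by
      by_contra hu0
      obtain ⟨z, hz⟩ := h3
      have hz0 : z ≠ 0 := by
        rintro rfl
        exact hu0 (by rw [hz, mul_zero])
      have h4 := congrArg MvPolynomial.totalDegree hz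
      rw [totalDegree_mul_of_isDomain hg0 hz0, IsHomogeneous.totalDegree u.2 hu0,
        hg.totalDegree hg0] at h4
      omega
    have hv : v.1 = 0 := by
      rw [hu, mul_zero, zero_add] at h1
      exact (mul_eq_zero.1 h1).resolve_left hg0
    ext1
    · exact Subtype.ext hu
    · exact Subtype.ext hv
  have hsurj : Function.Surjective ψ := by
    refine (LinearMap.injective_iff_surjective_of_finrank_eq_finrank ?_).1 hinj
    rw [Module.finrank_prod, finrank_binaryForms, finrank_binaryForms, finrank_binaryForms]
    ring
  obtain ⟨⟨u, v⟩, huv⟩ := hsurj ⟨w, hw⟩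
  exact ⟨u.1, v.1, u.2, v.2, (congrArg Subtype.val huv).symm⟩

lemma homogeneousSubmodule_mul_eq (σ K : Type*) [Field K] (a b : ℕ) :
    homogeneousSubmodule σ K a * homogeneousSubmodule σ K b =
      homogeneousSubmodule σ K (a + b) := by
  rw [← homogeneousSubmodule_one_pow K a, ← homogeneousSubmodule_one_pow K b, ← pow_add,
    homogeneousSubmodule_one_pow]

/-- Coprime binary forms of positive degrees `a + 1` and `b + 1` generate all forms of degree at
least `a + b + 1`. -/
lemma exists_combination_of_isRelPrime {K : Type*} [Field K] {f g : MvPolynomial (Fin 2) K}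
    {a b : ℕ} (hf : f.IsHomogeneous (a + 1)) (hg : g.IsHomogeneous (b + 1))
    (hg0 : g ≠ 0) (hrel : IsRelPrime f g) {w : MvPolynomial (Fin 2) K} {e : ℕ}
    (hw : w.IsHomogeneous (a + b + 1 + e)) :
    ∃ u v : MvPolynomial (Fin 2) K, u.IsHomogeneous (b + e) ∧ v.IsHomogeneous (a + e) ∧
      w = f * u + g * v := by
  have hw' : w ∈ homogeneousSubmodule (Fin 2) K (a + b + 1) * homogeneousSubmodule (Fin 2) K e := by
    rw [homogeneousSubmodule_mul_eq]
    exact hw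
  induction hw' using Submodule.mul_induction_on' with
  | mem_mul_mem x hx y hy =>
    obtain ⟨u, v, hu, hv, rfl⟩ := exists_combination_of_isRelPrime_aux hf hg hg0 hrel hx
    exact ⟨u * y, v * y, hu.mul hy, hv.mul hy, by ring⟩
  | add x hx y hy hx' hy' =>
    rw [homogeneousSubmodule_mul_eq] at hx hy
    obtain ⟨u, v, hu, hv, rfl⟩ := hx' hx
    obtain ⟨u', v', hu', hv', rfl⟩ := hy' hy
    exact ⟨u + u', v + v', hu.add hu', hv.add hv', by ring⟩

/-- A form of degree `k` on `ℙ^n` restricts to a form of degree `n * k` on a rational normal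
curve, and every form of that degree arises. -/
lemma map_homogeneousSubmodule_aeval {K : Type*} [Field K] {n : ℕ}
    {p : Fin (n + 1) → MvPolynomial (Fin 2) K}
    (hp : Submodule.span K (Set.range p) = homogeneousSubmodule (Fin 2) K n) (k : ℕ) :
    (homogeneousSubmodule (Fin (n + 1)) K k).map (aeval p).toLinearMap =
      homogeneousSubmodule (Fin 2) K (n * k) := by
  rw [← homogeneousSubmodule_one_pow K k, Submodule.map_pow, homogeneousSubmodule_one_eq_span_X,
    Submodule.map_span, ← Set.range_comp]
  have : (⇑(aeval p : MvPolynomial (Fin (n + 1)) K →ₐ[K] _).toLinearMap ∘ X) = p := by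
    ext1 i
    simp
  rw [this, hp, ← homogeneousSubmodule_one_pow K n, ← pow_mul, homogeneousSubmodule_one_pow]

/-- Elements of the saturation of a homogeneous ideal: it suffices to test on forms of large
degree. -/
lemma mem_saturate_of_forall {K : Type} [Field K] {n : ℕ} {I : Ideal (MvPolynomial (Fin (n + 1)) K)}
    {F : MvPolynomial (Fin (n + 1)) K} (l : ℕ)
    (h : ∀ G : MvPolynomial (Fin (n + 1)) K, G.IsHomogeneous l → F * G ∈ I) :
    F ∈ saturate I := by
  refine Submodule.mem_iSup_of_mem l ?_
  rw [Submodule.mem_colon]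
  intro G hG
  rw [irrelevantIdeal, SetLike.mem_coe, Ideal.mem_span_pow_iff_exists_isHomogeneous] at hG
  obtain ⟨q, hq, rfl⟩ := hG
  rw [smul_eq_mul, eval_eq, Finset.mul_sum]
  refine I.sum_mem fun d hd => ?_
  rw [mul_left_comm]
  refine I.mul_mem_left _ (h _ ?_)
  have := hq.degree_eq_sum_deg_support hd
  rw [this]
  exact IsHomogeneous.prod _ _ _ fun i _ => isHomogeneous_X_pow i (d i)

lemma finrank_map_add_finrank_ker_inf {K V W : Type*} [Field K] [AddCommGroup V] [Module K V]
    [AddCommGroup W] [Module K W] (f : V →ₗ[K] W) (U : Submodule K V) [Module.Finite K U] :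
    Module.finrank K ↥(U.map f) + Module.finrank K ↥(LinearMap.ker f ⊓ U) =
      Module.finrank K U := by
  have h := LinearMap.finrank_range_add_finrank_ker (f.domRestrict U)
  rwa [LinearMap.range_domRestrict, LinearMap.ker_domRestrict, ← Submodule.finrank_map_subtype_eq,
    Submodule.map_comap_subtype, inf_comm] at h

lemma hilbF_add_finrank {K : Type} [Field K] {n : ℕ} (I : Ideal (MvPolynomial (Fin (n + 1)) K))
    (k : ℕ) :
    hilbF I k + Module.finrank K
      ↥(I.restrictScalars K ⊓ homogeneousSubmodule (Fin (n + 1)) K k) =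
      Module.finrank K (homogeneousSubmodule (Fin (n + 1)) K k) := by
  have h := finrank_map_add_finrank_ker_inf (Ideal.Quotient.mkₐ K I).toLinearMap
    (homogeneousSubmodule (Fin (n + 1)) K k)
  have hker : LinearMap.ker (Ideal.Quotient.mkₐ K I).toLinearMap = I.restrictScalars K := by
    ext F
    simp [Ideal.Quotient.eq_zero_iff_mem]
  rwa [hker] at h

/-- The binary form `f` of degree `e` cuts out a subscheme of the rational normal curve
parametrized by `p` which contains the scheme of `I`: all forms on `ℙ^n` whose restriction to the
curve is a multiple of `f` lie in `I`. -/
def MultiplesIn {K : Type} [Field K] {n : ℕ} (p : Fin (n + 1) → MvPolynomial (Fin 2) K)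
    (I : Ideal (MvPolynomial (Fin (n + 1)) K)) (f : MvPolynomial (Fin 2) K) (e : ℕ) : Prop :=
  ∀ (k : ℕ) (F : MvPolynomial (Fin (n + 1)) K) (w : MvPolynomial (Fin 2) K) (e' : ℕ),
    F.IsHomogeneous k → w.IsHomogeneous e' → e + e' = n * k → aeval p F = f * w → F ∈ I

lemma multiplesIn_aeval {K : Type} [Field K] {n : ℕ} (hn : 1 ≤ n)
    {p : Fin (n + 1) → MvPolynomial (Fin 2) K}
    (hp : Submodule.span K (Set.range p) = homogeneousSubmodule (Fin 2) K n)
    {I : Ideal (MvPolynomial (Fin (n + 1)) K)}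
    (hker : ∀ F : MvPolynomial (Fin (n + 1)) K, aeval p F = 0 → F ∈ I)
    {F : MvPolynomial (Fin (n + 1)) K} {k : ℕ} (hF : F ∈ I) :
    MultiplesIn p I (aeval p F) (n * k) := by
  intro k' F' w e' hF' hw he hFw
  have hk : k ≤ k' := by
    by_contra hlt
    have := Nat.mul_le_mul_left n (by omega : k' + 1 ≤ k)
    rw [mul_add] at this
    omega
  obtain ⟨j, rfl⟩ := Nat.exists_eq_add_of_le hk
  have hj : e' = n * j := by
    rw [mul_add] at he
    omega
  subst hj
  have hw' : w ∈ homogeneousSubmodule (Fin 2) K (n * j) := hw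
  rw [← map_homogeneousSubmodule_aeval hp] at hw'
  obtain ⟨G, -, rfl⟩ := hw'
  have h := hker (F' - F * G) (by
    rw [map_sub, map_mul, hFw]
    exact sub_self _)
  have := I.add_mem h (I.mul_mem_right G hF)
  simpa using this

/-- On a rational normal curve, every finite subscheme is cut out by a single binary form. -/
lemma exists_binaryForm_generator {K : Type} [Field K] {n : ℕ} (hn : 1 ≤ n)
    {p : Fin (n + 1) → MvPolynomial (Fin 2) K} (hph : ∀ i, (p i).IsHomogeneous n)
    (hp : Submodule.span K (Set.range p) = homogeneousSubmodule (Fin 2) K n)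
    {I : Ideal (MvPolynomial (Fin (n + 1)) K)} (hsat : saturate I = I)
    (hker : ∀ F : MvPolynomial (Fin (n + 1)) K, aeval p F = 0 → F ∈ I)
    (hex : ∃ (k : ℕ) (F : MvPolynomial (Fin (n + 1)) K), F.IsHomogeneous k ∧ F ∈ I ∧
      aeval p F ≠ 0) :
    ∃ (D : ℕ) (g : MvPolynomial (Fin 2) K), g.IsHomogeneous D ∧ g ≠ 0 ∧
      ∀ (k : ℕ) (F : MvPolynomial (Fin (n + 1)) K), F.IsHomogeneous k →
        (F ∈ I ↔ g ∣ aeval p F) := by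
  have hφ : ∀ {k : ℕ} {F : MvPolynomial (Fin (n + 1)) K}, F.IsHomogeneous k →
      (aeval p F).IsHomogeneous (n * k) := fun hF => hF.aeval p hph
  have hlift : ∀ {k : ℕ} {w : MvPolynomial (Fin 2) K}, w.IsHomogeneous (n * k) →
      ∃ G : MvPolynomial (Fin (n + 1)) K, G.IsHomogeneous k ∧ aeval p G = w := by
    intro k w hw
    have hw' : w ∈ homogeneousSubmodule (Fin 2) K (n * k) := hw
    rw [← map_homogeneousSubmodule_aeval hp] at hw'
    exact hw'
  have hexD : ∃ D, ∃ g : MvPolynomial (Fin 2) K, g.IsHomogeneous D ∧ g ≠ 0 ∧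
      MultiplesIn p I g D := by
    obtain ⟨k, F, hF, hFI, hF0⟩ := hex
    exact ⟨n * k, aeval p F, hφ hF, hF0, multiplesIn_aeval hn hp hker hFI⟩
  obtain ⟨g, hg, hg0, hgT⟩ := Nat.find_spec hexD
  have hmin : ∀ m, m < Nat.find hexD → ¬ ∃ g : MvPolynomial (Fin 2) K, g.IsHomogeneous m ∧ g ≠ 0 ∧
      MultiplesIn p I g m := fun m hm => Nat.find_min hexD hm
  generalize Nat.find hexD = D at *
  refine ⟨D, g, hg, hg0, fun k F hF => ⟨fun hFI => ?_, fun hdvd => ?_⟩⟩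
  · by_contra hndvd
    have hf0 : aeval p F ≠ 0 := by
      intro h
      exact hndvd (h ▸ dvd_zero g)
    have hfT := multiplesIn_aeval hn hp hker (k := k) hFI
    have hf := hφ hF
    generalize aeval p F = f at *
    generalize n * k = E at hf hfT
    let _ : GCDMonoid (MvPolynomial (Fin 2) K) :=
      UniqueFactorizationMonoid.toGCDMonoid _
    obtain ⟨f', g', hf', hg', hunit⟩ := extract_gcd f g
    have hrel : IsRelPrime f' g' := gcd_isUnit_iff_isRelPrime.1 hunit
    generalize gcd f g = c at hf' hg'
    have hc0 : c ≠ 0 := left_ne_zero_of_mul (hf' ▸ hf0)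
    have hf'0 : f' ≠ 0 := right_ne_zero_of_mul (hf' ▸ hf0)
    have hg'0 : g' ≠ 0 := right_ne_zero_of_mul (hg' ▸ hg0)
    obtain ⟨γ, hc⟩ := exists_isHomogeneous_of_mul (hf' ▸ hf) (hf' ▸ hf0)
    obtain ⟨a, ha⟩ := exists_isHomogeneous_of_mul (mul_comm c f' ▸ hf' ▸ hf)
      (mul_comm c f' ▸ hf' ▸ hf0)
    obtain ⟨b, hb⟩ := exists_isHomogeneous_of_mul (mul_comm c g' ▸ hg' ▸ hg)
      (mul_comm c g' ▸ hg' ▸ hg0)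
    have hE : E = γ + a := IsHomogeneous.inj_right (hf' ▸ hf) (hc.mul ha) (hf' ▸ hf0)
    have hD : D = γ + b := IsHomogeneous.inj_right (hg' ▸ hg) (hc.mul hb) (hg' ▸ hg0)
    have hDE : D ≤ E := by
      by_contra hlt
      exact hmin E (by omega) ⟨f, hf, hf0, hfT⟩
    have hb0 : b ≠ 0 := by
      rintro rfl
      apply hndvd
      have hgu : IsUnit g' := by
        rw [← totalDegree_zero_iff_isHomogeneous, totalDegree_eq_zero_iff_eq_C] at hb
        rw [hb] at hg'0 ⊢
        exact (IsUnit.mk0 _ (by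
          rintro h
          exact hg'0 (by rw [h, C_0]))).map C
      rw [hg', hf']
      exact mul_dvd_mul_left c (hgu.dvd)
    obtain ⟨b, rfl⟩ := Nat.exists_eq_succ_of_ne_zero hb0
    obtain ⟨a, rfl⟩ := Nat.exists_eq_succ_of_ne_zero (by omega : a ≠ 0)
    refine hmin γ (by omega) ⟨c, hc, hc0, ?_⟩
    intro k F y e' hF hy he hFy
    rw [← hsat]
    refine mem_saturate_of_forall (a + b + 1) fun G hG => ?_
    have hyG : (y * aeval p G).IsHomogeneous
        (a + b + 1 + (e' + (n - 1) * (a + b + 1))) := by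
      have := hy.mul (hφ hG)
      convert this using 1
      obtain ⟨n', rfl⟩ := Nat.exists_eq_add_of_le hn
      simp only [Nat.add_sub_cancel_left]
      ring
    have hdeg : n * (a + b + 1) = (a + b + 1) + (n - 1) * (a + b + 1) := by
      obtain ⟨n', rfl⟩ := Nat.exists_eq_add_of_le hn
      simp only [Nat.add_sub_cancel_left]
      ring
    obtain ⟨u, v, hu, hv, huv⟩ := exists_combination_of_isRelPrime ha hb hg'0 hrel hyG
    have hfu : (f * u).IsHomogeneous (n * (k + (a + b + 1))) := by
      have := hf.mul hu
      convert this using 1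
      rw [mul_add, hdeg]
      omega
    have hgv : (g * v).IsHomogeneous (n * (k + (a + b + 1))) := by
      have := hg.mul hv
      convert this using 1
      rw [mul_add, hdeg]
      omega
    obtain ⟨F1, hF1, hF1'⟩ := hlift hfu
    obtain ⟨F2, hF2, hF2'⟩ := hlift hgv
    have h1 : F1 ∈ I := hfT _ F1 u _ hF1 hu (by rw [mul_add n k, hdeg]; omega) hF1'
    have h2 : F2 ∈ I := hgT _ F2 v _ hF2 hv (by rw [mul_add n k, hdeg]; omega) hF2'
    have h3 : F * G - F1 - F2 ∈ I := by
      apply hker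
      rw [map_sub, map_sub, map_mul, hF1', hF2', hFy, mul_assoc, huv, hf', hg']
      ring
    have h4 := I.add_mem (I.add_mem h3 h1) h2
    have h5 : F * G - F1 - F2 + F1 + F2 = F * G := by ring
    rwa [h5] at h4
  · obtain ⟨w, hw⟩ := hdvd
    by_cases h0 : aeval p F = 0
    · exact hker F h0
    · have hh := hφ hF
      rw [hw] at hh h0
      obtain ⟨e', he'⟩ := exists_isHomogeneous_of_mul (mul_comm g w ▸ hh) (mul_comm g w ▸ h0)
      exact hgT k F w e' hF he' (IsHomogeneous.inj_right (hg.mul he') hh h0) hw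

/-- The Hilbert function of `I` can be computed from any linear map whose kernel agrees with `I`
in the given degree. -/
lemma hilbF_eq_finrank_map {K : Type} [Field K] {n : ℕ}
    (I : Ideal (MvPolynomial (Fin (n + 1)) K)) (k : ℕ) {W : Type*} [AddCommGroup W] [Module K W]
    (f : MvPolynomial (Fin (n + 1)) K →ₗ[K] W)
    (hf : ∀ F : MvPolynomial (Fin (n + 1)) K, F.IsHomogeneous k → (F ∈ I ↔ f F = 0)) :
    hilbF I k = Module.finrank K ↥((homogeneousSubmodule (Fin (n + 1)) K k).map f) := by
  have h1 := hilbF_add_finrank I k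
  have h2 := finrank_map_add_finrank_ker_inf f (homogeneousSubmodule (Fin (n + 1)) K k)
  have h3 : I.restrictScalars K ⊓ homogeneousSubmodule (Fin (n + 1)) K k =
      LinearMap.ker f ⊓ homogeneousSubmodule (Fin (n + 1)) K k := by
    ext F
    simp only [Submodule.mem_inf, Submodule.restrictScalars_mem, LinearMap.mem_ker]
    exact and_congr_left fun hF => hf F hF
  rw [h3] at h1
  omega

lemma finrank_map_mk_binaryForms {K : Type*} [Field K] {g : MvPolynomial (Fin 2) K} {D : ℕ}
    (hg : g.IsHomogeneous D) (hg0 : g ≠ 0) (e : ℕ) :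
    Module.finrank K ↥((homogeneousSubmodule (Fin 2) K e).map
      (Ideal.Quotient.mkₐ K (Ideal.span {g})).toLinearMap) = min (e + 1) D := by
  have h := finrank_map_add_finrank_ker_inf (Ideal.Quotient.mkₐ K (Ideal.span {g})).toLinearMap
    (homogeneousSubmodule (Fin 2) K e)
  rw [finrank_binaryForms] at h
  have hmem : ∀ w, w ∈ LinearMap.ker (Ideal.Quotient.mkₐ K (Ideal.span {g})).toLinearMap ↔
      g ∣ w := by
    intro w
    simp [Ideal.Quotient.eq_zero_iff_mem, Ideal.mem_span_singleton]
  have hcof : ∀ w, g ∣ w → w.IsHomogeneous e → w ≠ 0 →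
      ∃ j z, MvPolynomial.IsHomogeneous z j ∧ w = g * z ∧ e = D + j := by
    rintro w ⟨z, rfl⟩ hw hw0
    obtain ⟨j, hj⟩ := exists_isHomogeneous_of_mul (mul_comm g z ▸ hw) (mul_comm g z ▸ hw0)
    exact ⟨j, z, hj, rfl, hw.inj_right (hg.mul hj) hw0⟩
  rcases lt_or_ge e D with hlt | hge
  · have hbot : LinearMap.ker (Ideal.Quotient.mkₐ K (Ideal.span {g})).toLinearMap ⊓
        homogeneousSubmodule (Fin 2) K e = ⊥ := by
      rw [eq_bot_iff]
      rintro w ⟨hw1, hw2⟩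
      by_contra hw0
      obtain ⟨j, z, -, -, hj⟩ := hcof w ((hmem w).1 hw1) hw2 hw0
      omega
    rw [hbot, finrank_bot] at h
    omega
  · obtain ⟨j, rfl⟩ := Nat.exists_eq_add_of_le hge
    have hmap : LinearMap.ker (Ideal.Quotient.mkₐ K (Ideal.span {g})).toLinearMap ⊓
        homogeneousSubmodule (Fin 2) K (D + j) =
        (homogeneousSubmodule (Fin 2) K j).map (LinearMap.mulLeft K g) := by
      ext w
      rw [Submodule.mem_inf, hmem, Submodule.mem_map]
      constructor
      · rintro ⟨hw1, hw2⟩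
        by_cases hw0 : w = 0
        · exact ⟨0, zero_mem _, by simp [hw0]⟩
        · obtain ⟨j', z, hz, rfl, hj'⟩ := hcof w hw1 hw2 hw0
          obtain rfl : j = j' := by omega
          exact ⟨z, hz, rfl⟩
      · rintro ⟨z, hz, rfl⟩
        exact ⟨⟨z, rfl⟩, hg.mul hz⟩
    have hinj : Function.Injective (LinearMap.mulLeft K g) := fun x y hxy =>
      mul_left_cancel₀ hg0 hxy
    rw [hmap, ← (Submodule.equivMapOfInjective _ hinj _).finrank_eq, finrank_binaryForms] at h
    omega

lemma schemeDeg_eq_of_eventually {K : Type} [Field K] {n : ℕ}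
    {I : Ideal (MvPolynomial (Fin (n + 1)) K)} {d : ℕ} (h : ∀ᶠ m : ℕ in atTop, hilbF I m = d) :
    schemeDeg I = d := by
  have hex : ∃ d : ℕ, ∀ᶠ m : ℕ in atTop, hilbF I m = d := ⟨d, h⟩
  rw [schemeDeg, dif_pos hex]
  obtain ⟨m, h1, h2⟩ := (hex.choose_spec.and h).exists
  exact h1.symm.trans h2

/-- The Hilbert function of a finite subscheme of a rational normal curve. -/
lemma hilbF_of_le_rationalNormalCurve {K : Type} [Field K] {n : ℕ} (hn : 1 ≤ n)
    {p : Fin (n + 1) → MvPolynomial (Fin 2) K} (hph : ∀ i, (p i).IsHomogeneous n)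
    (hp : Submodule.span K (Set.range p) = homogeneousSubmodule (Fin 2) K n)
    {I : Ideal (MvPolynomial (Fin (n + 1)) K)} (hfin : IsFiniteSubscheme I)
    (hker : ∀ F : MvPolynomial (Fin (n + 1)) K, aeval p F = 0 → F ∈ I) (k : ℕ) :
    hilbF I k = min (n * k + 1) (schemeDeg I) := by
  have hlarge : ∀ d : ℕ, ∀ᶠ m : ℕ in atTop, d < n * m + 1 := by
    intro d
    filter_upwards [eventually_ge_atTop d] with m hm
    nlinarith
  have hex : ∃ (k : ℕ) (F : MvPolynomial (Fin (n + 1)) K), F.IsHomogeneous k ∧ F ∈ I ∧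
      aeval p F ≠ 0 := by
    by_contra! hno
    obtain ⟨d, -, hd⟩ := hfin.finite
    obtain ⟨m, h1, h2⟩ := (hd.and (hlarge d)).exists
    rw [hilbF_eq_finrank_map I m (aeval p).toLinearMap
      (fun F hF => ⟨fun h => hno m F hF h, fun h => hker F h⟩), map_homogeneousSubmodule_aeval hp,
      finrank_binaryForms] at h1
    omega
  obtain ⟨D, g, hg, hg0, hgI⟩ := exists_binaryForm_generator hn hph hp hfin.saturated hker hex
  have hil : ∀ k, hilbF I k = min (n * k + 1) D := by
    intro k
    rw [hilbF_eq_finrank_map I k ((Ideal.Quotient.mkₐ K (Ideal.span {g})).toLinearMap.comp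
      (aeval p).toLinearMap), Submodule.map_comp, map_homogeneousSubmodule_aeval hp,
      finrank_map_mk_binaryForms hg hg0]
    intro F hF
    rw [hgI k F hF]
    simp [Ideal.Quotient.eq_zero_iff_mem, Ideal.mem_span_singleton]
  have hD : schemeDeg I = D := by
    apply schemeDeg_eq_of_eventually
    filter_upwards [hlarge D] with m hm
    rw [hil]
    omega
  rw [hil, hD]

/-- The `2 × 2` minors of the catalecticant matrix cut out the standard rational normal curve. -/
lemma exists_eq_pow_mul_pow {K : Type*} [Field K] [IsAlgClosed K] {n : ℕ} (hn : 1 ≤ n) (y : ℕ → K)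
    (h : ∀ i < n, ∀ j < n, y i * y (j + 1) = y (i + 1) * y j) :
    ∃ s t : K, ∀ j ≤ n, y j = s ^ j * t ^ (n - j) := by
  by_cases h0 : y 0 = 0
  · have hz : ∀ j < n, y j = 0 := by
      intro j
      induction j with
      | zero => exact fun _ => h0
      | succ j ih =>
        intro hj
        have h1 := h j (by omega) (j + 1) hj
        rw [ih (by omega), zero_mul] at h1
        exact mul_self_eq_zero.1 h1.symm
    obtain ⟨s, hs⟩ := IsAlgClosed.exists_pow_nat_eq (y n) (by omega : 0 < n)
    refine ⟨s, 0, fun j hj => ?_⟩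
    rcases hj.lt_or_eq with hj | rfl
    · rw [hz j hj, zero_pow (by omega), mul_zero]
    · simp [hs]
  · obtain ⟨t, ht⟩ := IsAlgClosed.exists_pow_nat_eq (y 0) (by omega : 0 < n)
    refine ⟨y 1 / y 0 * t, t, fun j hj => ?_⟩
    have h1 : y j = (y 1 / y 0) ^ j * y 0 := by
      induction j with
      | zero => simp
      | succ j ih =>
        have h2 := h 0 (by omega) j (by omega)
        rw [zero_add, ih (by omega)] at h2
        rw [pow_succ]
        field_simp at h2 ⊢
        linear_combination h2
    rw [h1, mul_pow, mul_assoc, ← pow_add, ← ht]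
    congr 2
    omega

lemma binaryForms_eq_span (K : Type*) [Field K] (n : ℕ) :
    homogeneousSubmodule (Fin 2) K n =
      Submodule.span K ((fun j => (X 0 ^ j * X 1 ^ (n - j) : MvPolynomial (Fin 2) K)) ''
        Set.Iic n) := by
  apply le_antisymm
  · intro f hf
    rw [f.as_sum]
    refine Submodule.sum_mem _ fun d hd => ?_
    have hde : d.degree = n := by
      rw [Finsupp.degree_apply]
      exact (IsHomogeneous.degree_eq_sum_deg_support hf hd).symm
    rw [Finsupp.degree_eq_sum, Fin.sum_univ_two] at hde
    have : monomial d (coeff d f) =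
        coeff d f • (X 0 ^ (d 0) * X 1 ^ (n - d 0) : MvPolynomial (Fin 2) K) := by
      rw [monomial_eq, Finsupp.prod_fintype _ _ (by simp), Fin.prod_univ_two, smul_eq_C_mul]
      congr
      omega
    rw [this]
    refine Submodule.smul_mem _ _ (Submodule.subset_span ⟨d 0, ?_, rfl⟩)
    rw [Set.mem_Iic]
    omega
  · rw [Submodule.span_le]
    rintro _ ⟨j, hj, rfl⟩
    have h := (isHomogeneous_X_pow (R := K) (0 : Fin 2) j).mul
      (isHomogeneous_X_pow (R := K) (1 : Fin 2) (n - j))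
    rw [Nat.add_sub_cancel' hj] at h
    exact h

/-- A point outside a rational normal curve is missed by some quadric containing the curve. -/
lemma exists_quadric_of_forall_ne {K : Type} [Field K] [IsAlgClosed K] {n : ℕ} (hn : 1 ≤ n)
    {p : Fin (n + 1) → MvPolynomial (Fin 2) K}
    (hp : Submodule.span K (Set.range p) = homogeneousSubmodule (Fin 2) K n)
    {a : Fin (n + 1) → K} (ha : ∀ x : Fin 2 → K, a ≠ fun i => eval x (p i)) :
    ∃ Q : MvPolynomial (Fin (n + 1)) K, Q.IsHomogeneous 2 ∧ aeval p Q = 0 ∧ eval a Q ≠ 0 := by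
  have hli : LinearIndependent K p := by
    rw [linearIndependent_iff_card_eq_finrank_span, Set.finrank, hp, finrank_binaryForms,
      Fintype.card_fin]
  obtain ⟨ev, hev⟩ : ∃ ev : MvPolynomial (Fin 2) K →ₗ[K] K, ∀ i, ev (p i) = a i := by
    obtain ⟨ev, hev⟩ := LinearMap.exists_extend ((Module.Basis.span hli).constr K a)
    refine ⟨ev, fun i => ?_⟩
    have h1 := LinearMap.congr_fun hev (Module.Basis.span hli i)
    rw [Module.Basis.constr_basis, LinearMap.comp_apply, Submodule.subtype_apply,
      Module.Basis.span_apply] at h1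
    exact h1
  let q : ℕ → MvPolynomial (Fin 2) K := fun j => X 0 ^ j * X 1 ^ (n - j)
  have hL : ∀ j ≤ n, ∃ L : MvPolynomial (Fin (n + 1)) K, L.IsHomogeneous 1 ∧ aeval p L = q j ∧
      eval a L = ev (q j) := by
    intro j hj
    have hq : q j ∈ Submodule.span K (Set.range p) := by
      rw [hp, binaryForms_eq_span]
      exact Submodule.subset_span ⟨j, hj, rfl⟩
    obtain ⟨c, hc⟩ := (Submodule.mem_span_range_iff_exists_fun K).1 hq
    refine ⟨∑ i, C (c i) * X i, IsHomogeneous.sum _ _ _ fun i _ => isHomogeneous_C_mul_X _ _, ?_, ?_⟩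
    · rw [← hc]
      simp [smul_eq_C_mul]
    · rw [← hc]
      simp [hev]
  choose! L hL1 hLq hLa using hL
  by_contra! hno
  obtain ⟨s, t, hst⟩ := exists_eq_pow_mul_pow hn (fun j => ev (q j)) (by
    intro i hi j hj
    have h1 := hno (L i * L (j + 1) - L (i + 1) * L j)
      (((hL1 i hi.le).mul (hL1 (j + 1) hj)).sub ((hL1 (i + 1) hi).mul (hL1 j hj.le))) (by
        simp only [map_sub, map_mul, hLq i hi.le, hLq (j + 1) hj, hLq (i + 1) hi, hLq j hj.le, q]
        obtain ⟨i', rfl⟩ := Nat.exists_eq_add_of_lt hi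
        rw [show i + i' + 1 - i = i' + 1 by omega, show i + i' + 1 - (i + 1) = i' by omega]
        obtain ⟨j', hj'⟩ := Nat.exists_eq_add_of_lt hj
        rw [hj', show j + j' + 1 - j = j' + 1 by omega, show j + j' + 1 - (j + 1) = j' by omega]
        ring)
    rw [map_sub, map_mul, map_mul, hLa i hi.le, hLa (j + 1) hj, hLa (i + 1) hi, hLa j hj.le] at h1
    exact sub_eq_zero.1 h1)
  apply ha ![s, t]
  ext i
  have hpi : p i ∈ homogeneousSubmodule (Fin 2) K n := hp ▸ Submodule.subset_span ⟨i, rfl⟩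
  have heq : ∀ f ∈ homogeneousSubmodule (Fin 2) K n, ev f = eval ![s, t] f := by
    intro f hf
    rw [binaryForms_eq_span] at hf
    induction hf using Submodule.span_induction with
    | mem f hf =>
      obtain ⟨j, hj, rfl⟩ := hf
      have := hst j hj
      simpa [q] using this
    | zero => simp
    | add f g _ _ hf hg => rw [map_add, map_add, hf, hg]
    | smul c f _ hf => rw [map_smul, smul_eval, hf, smul_eq_mul]
  rw [← hev, heq _ hpi]

lemma eval_smul_of_isHomogeneous {σ K : Type*} [Field K] {F : MvPolynomial σ K} {k : ℕ}
    (hF : F.IsHomogeneous k) (c : K) (a : σ → K) : eval (c • a) F = c ^ k * eval a F := by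
  rw [eval_eq, eval_eq, Finset.mul_sum]
  refine Finset.sum_congr rfl fun d hd => ?_
  have := hF.degree_eq_sum_deg_support hd
  simp only [Pi.smul_apply, smul_eq_mul, mul_pow, Finset.prod_mul_distrib,
    Finset.prod_pow_eq_pow_sum, this]
  ring

lemma mem_pointIdeal_iff {K : Type} [Field K] {n : ℕ} {P : Projectivization K (Fin (n + 1) → K)}
    {F : MvPolynomial (Fin (n + 1)) K} {k : ℕ} (hF : F.IsHomogeneous k) :
    F ∈ pointIdeal P ↔ eval P.rep F = 0 := by
  simp only [pointIdeal, Submodule.mem_iInf, RingHom.mem_ker, eval_smul_of_isHomogeneous hF]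
  constructor
  · intro h
    simpa using h 1
  · intro h c
    rw [h, mul_zero]

lemma exists_quadric_of_not_le_pointIdeal {K : Type} [Field K] [IsAlgClosed K] {n : ℕ} (hn : 1 ≤ n)
    {p : Fin (n + 1) → MvPolynomial (Fin 2) K} (hph : ∀ i, (p i).IsHomogeneous n)
    (hp : Submodule.span K (Set.range p) = homogeneousSubmodule (Fin 2) K n)
    {P : Projectivization K (Fin (n + 1) → K)}
    (hP : ¬ (⨅ x : Fin 2 → K, RingHom.ker (eval (fun i => eval x (p i)) :
      MvPolynomial (Fin (n + 1)) K →+* K)) ≤ pointIdeal P) :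
    ∃ Q : MvPolynomial (Fin (n + 1)) K, Q.IsHomogeneous 2 ∧ aeval p Q = 0 ∧ eval P.rep Q ≠ 0 := by
  apply exists_quadric_of_forall_ne hn hp
  intro x hx
  apply hP
  intro F hF
  simp only [Submodule.mem_iInf, RingHom.mem_ker] at hF
  simp only [pointIdeal, Submodule.mem_iInf, RingHom.mem_ker]
  intro c
  obtain ⟨b, rfl⟩ := IsAlgClosed.exists_pow_nat_eq c (by omega : 0 < n)
  have hb : (b ^ n • fun i => eval x (p i)) = fun i => eval (b • x) (p i) := by
    ext i
    simp [eval_smul_of_isHomogeneous (hph i)]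
  rw [hx, hb]
  exact hF (b • x)

/-- Distinct points of projective space are separated by a linear form. -/
lemma exists_linearForm_separating {K : Type*} [Field K] {n : ℕ}
    {P P' : Projectivization K (Fin (n + 1) → K)} (h : P ≠ P') :
    ∃ L : MvPolynomial (Fin (n + 1)) K, L.IsHomogeneous 1 ∧ eval P'.rep L = 0 ∧
      eval P.rep L ≠ 0 := by
  have hnot : P.rep ∉ Submodule.span K {P'.rep} := by
    rw [Submodule.mem_span_singleton]
    rintro ⟨c, hc⟩
    apply h
    rw [← P.mk_rep, ← P'.mk_rep, Projectivization.mk_eq_mk_iff']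
    exact ⟨c, hc⟩
  obtain ⟨f, hf, hle⟩ := Submodule.exists_le_ker_of_notMem hnot
  have heval : ∀ a : Fin (n + 1) → K, eval a (∑ i, C (f (Pi.single i 1)) * X i) = f a := by
    intro a
    conv_rhs => rw [pi_eq_sum_univ' a]
    simp [mul_comm]
  refine ⟨∑ i, C (f (Pi.single i 1)) * X i,
    IsHomogeneous.sum _ _ _ fun i _ => isHomogeneous_C_mul_X _ _, ?_, ?_⟩
  · rw [heval]
    exact hle (Submodule.mem_span_singleton_self _)
  · rwa [heval]

lemma exists_linearForm_ne_zero {K : Type*} [Field K] {n : ℕ}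
    (P : Projectivization K (Fin (n + 1) → K)) :
    ∃ L : MvPolynomial (Fin (n + 1)) K, L.IsHomogeneous 1 ∧ eval P.rep L ≠ 0 := by
  obtain ⟨i, hi⟩ := Function.ne_iff.1 P.rep_nonzero
  exact ⟨X i, isHomogeneous_X K i, by simpa using hi⟩

/-- Evaluation at chosen representatives of the points of `A`. -/
noncomputable def evalPoints {K : Type} [Field K] {n : ℕ}
    (A : Finset (Projectivization K (Fin (n + 1) → K))) :
    MvPolynomial (Fin (n + 1)) K →ₗ[K] (A → K) :=
  LinearMap.pi fun P => (aeval P.1.rep).toLinearMap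

lemma evalPoints_apply {K : Type} [Field K] {n : ℕ}
    (A : Finset (Projectivization K (Fin (n + 1) → K))) (F : MvPolynomial (Fin (n + 1)) K) (P : A) :
    evalPoints A F P = eval P.1.rep F := by
  simp [evalPoints, aeval_eq_eval]

lemma mem_idealOfFinset_iff {K : Type} [Field K] {n : ℕ}
    {A : Finset (Projectivization K (Fin (n + 1) → K))} {F : MvPolynomial (Fin (n + 1)) K} {k : ℕ}
    (hF : F.IsHomogeneous k) : F ∈ idealOfFinset A ↔ evalPoints A F = 0 := by
  simp only [idealOfFinset, Submodule.mem_iInf, mem_pointIdeal_iff hF, funext_iff, evalPoints_apply,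
    Pi.zero_apply, Subtype.forall]

lemma hilbF_inf_idealOfFinset {K : Type} [Field K] {n : ℕ}
    (I : Ideal (MvPolynomial (Fin (n + 1)) K)) (A : Finset (Projectivization K (Fin (n + 1) → K)))
    (k : ℕ) :
    hilbF (I ⊓ idealOfFinset A) k = hilbF I k + Module.finrank K
      ↥((I.restrictScalars K ⊓ homogeneousSubmodule (Fin (n + 1)) K k).map (evalPoints A)) := by
  have h1 := hilbF_add_finrank I k
  have h2 := hilbF_add_finrank (I ⊓ idealOfFinset A) k
  have : Module.Finite K
      ↥(I.restrictScalars K ⊓ homogeneousSubmodule (Fin (n + 1)) K k) :=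
    Submodule.finiteDimensional_of_le inf_le_right
  have h3 := finrank_map_add_finrank_ker_inf (evalPoints A)
    (I.restrictScalars K ⊓ homogeneousSubmodule (Fin (n + 1)) K k)
  have h4 : LinearMap.ker (evalPoints A) ⊓
      (I.restrictScalars K ⊓ homogeneousSubmodule (Fin (n + 1)) K k) =
      (I ⊓ idealOfFinset A).restrictScalars K ⊓ homogeneousSubmodule (Fin (n + 1)) K k := by
    ext F
    simp only [Submodule.mem_inf, Submodule.restrictScalars_mem, LinearMap.mem_ker]
    constructor
    · rintro ⟨hA, hI, hF⟩
      exact ⟨⟨hI, (mem_idealOfFinset_iff hF).2 hA⟩, hF⟩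
    · rintro ⟨⟨hI, hA⟩, hF⟩
      exact ⟨(mem_idealOfFinset_iff hF).1 hA, hI, hF⟩
  rw [h4] at h3
  omega

lemma hilbF_inf_idealOfFinset_le {K : Type} [Field K] {n : ℕ}
    (I : Ideal (MvPolynomial (Fin (n + 1)) K)) (A : Finset (Projectivization K (Fin (n + 1) → K)))
    (k : ℕ) : hilbF (I ⊓ idealOfFinset A) k ≤ hilbF I k + A.card := by
  rw [hilbF_inf_idealOfFinset]
  have := Submodule.finrank_le
    ((I.restrictScalars K ⊓ homogeneousSubmodule (Fin (n + 1)) K k).map (evalPoints A))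
  rw [Module.finrank_fintype_fun_eq_card, Fintype.card_coe] at this
  omega

/-- If each point of `A` is missed by a quadric through the scheme of `I`, then in large degree the
points of `A` impose independent conditions on the forms in `I`. -/
lemma hilbF_inf_idealOfFinset_eq {K : Type} [Field K] {n : ℕ}
    {I : Ideal (MvPolynomial (Fin (n + 1)) K)} {A : Finset (Projectivization K (Fin (n + 1) → K))}
    (hA : ∀ P ∈ A, ∃ Q : MvPolynomial (Fin (n + 1)) K, Q.IsHomogeneous 2 ∧ Q ∈ I ∧
      eval P.rep Q ≠ 0) {k : ℕ} (hk : A.card + 1 ≤ k) :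
    hilbF (I ⊓ idealOfFinset A) k = hilbF I k + A.card := by
  have hsingle : ∀ P : A, Pi.single P 1 ∈
      (I.restrictScalars K ⊓ homogeneousSubmodule (Fin (n + 1)) K k).map (evalPoints A) := by
    intro P
    obtain ⟨Q, hQ, hQI, hQP⟩ := hA P.1 P.2
    obtain ⟨L₀, hL₀, hL₀P⟩ := exists_linearForm_ne_zero P.1
    have hsep : ∀ P' ∈ A.erase P.1, ∃ L : MvPolynomial (Fin (n + 1)) K, L.IsHomogeneous 1 ∧
        eval P'.rep L = 0 ∧ eval P.1.rep L ≠ 0 := fun P' hP' =>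
      exists_linearForm_separating (Finset.ne_of_mem_erase hP').symm
    choose! L hL hLP' hLP using hsep
    let G := Q * (∏ P' ∈ A.erase P.1, L P') * L₀ ^ (k - 1 - A.card)
    have hG : G.IsHomogeneous k := by
      have h1 := (hQ.mul (IsHomogeneous.prod _ _ _ hL)).mul (hL₀.pow (k - 1 - A.card))
      convert h1 using 1
      have := Finset.card_erase_add_one P.2
      simp only [Finset.sum_const, smul_eq_mul]
      omega
    have hGI : G ∈ I := I.mul_mem_right _ (I.mul_mem_right _ hQI)
    have hGP : eval P.1.rep G ≠ 0 := by
      simp only [G, map_mul, map_pow, map_prod]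
      exact mul_ne_zero (mul_ne_zero hQP (Finset.prod_ne_zero_iff.2 hLP)) (pow_ne_zero _ hL₀P)
    refine ⟨(eval P.1.rep G)⁻¹ • G, Submodule.smul_mem _ _ ⟨hGI, hG⟩, ?_⟩
    ext P'
    rw [map_smul, Pi.smul_apply, evalPoints_apply, smul_eq_mul]
    by_cases hPP : P' = P
    · subst hPP
      rw [Pi.single_eq_same, inv_mul_cancel₀ hGP]
    · have hmem : P'.1 ∈ A.erase P.1 :=
        Finset.mem_erase.2 ⟨fun h => hPP (Subtype.ext h), P'.2⟩
      have hGP' : eval P'.1.rep G = 0 := by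
        simp only [G, map_mul, map_pow, map_prod]
        rw [Finset.prod_eq_zero hmem (hLP' _ hmem), mul_zero, zero_mul]
      rw [Pi.single_eq_of_ne hPP, hGP', mul_zero]
  have htop : (I.restrictScalars K ⊓ homogeneousSubmodule (Fin (n + 1)) K k).map (evalPoints A) =
      ⊤ := by
    rw [eq_top_iff]
    intro x _
    rw [← Finset.univ_sum_single x]
    refine Submodule.sum_mem _ fun P _ => ?_
    have := Submodule.smul_mem _ (x P) (hsingle P)
    rwa [← Pi.single_smul, smul_eq_mul, mul_one] at this
  rw [hilbF_inf_idealOfFinset, htop, finrank_top, Module.finrank_fintype_fun_eq_card,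
    Fintype.card_coe]

lemma not_isFiniteSubscheme_of_isRNC_zero {K : Type} [Field K]
    {I C : Ideal (MvPolynomial (Fin (0 + 1)) K)} (hC : IsRNC 0 C) (hsub : C ≤ I) :
    ¬ IsFiniteSubscheme I := by
  intro hfin
  obtain ⟨p, hph, hp, rfl⟩ := hC
  have hp0 : ∃ c : K, p 0 = C c := by
    have := hph 0
    rw [← totalDegree_zero_iff_isHomogeneous, totalDegree_eq_zero_iff_eq_C] at this
    exact ⟨_, this⟩
  obtain ⟨c, hc⟩ := hp0
  have hc0 : c ≠ 0 := by
    rintro rfl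
    have h1 := finrank_binaryForms K 0
    rw [← hp] at h1
    have : Set.range p = {0} := by
      ext f
      simp [Fin.exists_fin_one, hc, eq_comm]
    rw [this, Submodule.span_zero_singleton, finrank_bot] at h1
    omega
  have hmem : (X 0 - C c : MvPolynomial (Fin (0 + 1)) K) ∈ I := by
    apply hsub
    simp [Submodule.mem_iInf, RingHom.mem_ker, hc]
  have hone : (1 : MvPolynomial (Fin (0 + 1)) K) ∈ I := by
    have h1 := homogeneousComponent_mem_of_mem hfin.homog hmem 0
    rw [homogeneousComponent_zero] at h1
    have h2 := I.mul_mem_left (C (-c)⁻¹) h1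
    rw [← C_mul] at h2
    simpa [hc0] using h2
  obtain ⟨d, hd0, hd⟩ := hfin.finite
  obtain ⟨m, hm⟩ := hd.exists
  have h0 : hilbF I m = 0 := by
    rw [hilbF_eq_finrank_map I m (0 : MvPolynomial (Fin (0 + 1)) K →ₗ[K] K), Submodule.map_zero,
      finrank_bot]
    intro F _
    simpa using (I.eq_top_iff_one.2 hone) ▸ Submodule.mem_top
  omega

/-- Theorem 5.1. -/
theorem stmt14 (K : Type) [Field K] [IsAlgClosed K] [CharZero K] (n d m : ℕ) (hm : 1 ≤ m)
    (I C : Ideal (MvPolynomial (Fin (n+1)) K))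
    (hfin : IsFiniteSubscheme I) (hC : IsRNC n C) (hsub : C ≤ I)
    (hdeg : schemeDeg I = d)
    (hd : 4*n^2 + 6*n + 1 + 2*(n+1)*m ≤ d)
    (A : Finset (Projectivization K (Fin (n+1) → K)))
    (hAcard : A.card ≤ m)
    (hAC : ∀ P ∈ A, ¬ C ≤ pointIdeal P)
    (hlgp : InLinGenPos (I ⊓ idealOfFinset A)) :
    schemeReg (I ⊓ idealOfFinset A) = schemeReg I ∧
      (schemeReg I : ℤ) = ⌈((d : ℚ) - 1) / (n : ℚ)⌉ + 1 := by
  rcases Nat.eq_zero_or_pos n with rfl | hn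
  · exact absurd hfin (not_isFiniteSubscheme_of_isRNC_zero hC hsub)
  obtain ⟨p, hph, hp, rfl⟩ := hC
  have hker : ∀ F : MvPolynomial (Fin (n + 1)) K, aeval p F = 0 →
      F ∈ (⨅ x : Fin 2 → K, RingHom.ker (eval (fun i => eval x (p i)) :
        MvPolynomial (Fin (n + 1)) K →+* K)) := by
    intro F hF
    simp only [Submodule.mem_iInf, RingHom.mem_ker]
    intro x
    have h : (eval x).comp (aeval p : MvPolynomial (Fin (n + 1)) K →ₐ[K] _).toRingHom =
        eval (fun i => eval x (p i)) := by
      ext i <;> simp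
    have h1 := RingHom.congr_fun h F
    rw [← h1]
    change eval x (aeval p F) = 0
    rw [hF, map_zero]
  have hil : ∀ k, hilbF I k = min (n * k + 1) d := fun k =>
    hdeg ▸ hilbF_of_le_rationalNormalCurve hn hph hp hfin (fun F hF => hsub (hker F hF)) k
  have hlarge : ∀ k, d ≤ n * k + 1 → A.card + 1 ≤ k := by
    intro k hk
    have h1 : n * (m + 1) ≤ n * k := by nlinarith
    have := Nat.le_of_mul_le_mul_left h1 hn
    omega
  have hquad : ∀ P ∈ A, ∃ Q : MvPolynomial (Fin (n + 1)) K, Q.IsHomogeneous 2 ∧ Q ∈ I ∧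
      eval P.rep Q ≠ 0 := by
    intro P hP
    obtain ⟨Q, hQ, hQp, hQP⟩ := exists_quadric_of_not_le_pointIdeal hn hph hp (hAC P hP)
    exact ⟨Q, hQ, hsub (hker Q hQp), hQP⟩
  have hilA : ∀ k, d ≤ n * k + 1 → hilbF (I ⊓ idealOfFinset A) k = d + A.card := by
    intro k hk
    rw [hilbF_inf_idealOfFinset_eq hquad (hlarge k hk), hil, min_eq_right hk]
  have hdegA : schemeDeg (I ⊓ idealOfFinset A) = d + A.card := by
    apply schemeDeg_eq_of_eventually
    filter_upwards [eventually_ge_atTop d] with k hk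
    exact hilA k (by nlinarith)
  have hiff : ∀ k, hilbF I k = d ↔ d ≤ n * k + 1 := by
    intro k
    rw [hil, min_eq_right_iff]
  have hiffA : ∀ k, hilbF (I ⊓ idealOfFinset A) k = d + A.card ↔ d ≤ n * k + 1 := by
    intro k
    refine ⟨fun h => ?_, hilA k⟩
    have h1 := hilbF_inf_idealOfFinset_le I A k
    have h2 := hil k
    omega
  simp only [schemeReg, hdeg, hdegA, hiff, hiffA, true_and]
  have hn' : (0 : ℚ) < n := by exact_mod_cast hn
  have hceil : ∀ k : ℕ, ⌈((d : ℚ) - 1) / (n : ℚ)⌉ ≤ (k : ℤ) ↔ d ≤ n * k + 1 := by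
    intro k
    rw [Int.ceil_le, div_le_iff₀ hn', sub_le_iff_le_add]
    push_cast
    rw [mul_comm]
    exact_mod_cast Iff.rfl
  have hnonneg : 0 ≤ ⌈((d : ℚ) - 1) / (n : ℚ)⌉ := by
    apply Int.ceil_nonneg
    apply div_nonneg _ hn'.le
    have : 1 ≤ d := by omega
    have : (1 : ℚ) ≤ d := by exact_mod_cast this
    linarith
  obtain ⟨r, hr⟩ := Int.eq_ofNat_of_zero_le hnonneg
  rw [hr] at hceil ⊢
  have hset : {p : ℕ | 1 ≤ p ∧ ∀ m : ℕ, p - 1 ≤ m → d ≤ n * m + 1} = Set.Ici (r + 1) := by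
    ext q
    simp only [Set.mem_ofPred_eq, Set.mem_Ici, ← hceil]
    constructor
    · rintro ⟨h1, h2⟩
      have := h2 (q - 1) le_rfl
      omega
    · intro h
      refine ⟨by omega, fun k hk => ?_⟩
      omega
  rw [hset, csInf_Ici]
  push_cast
  rfl
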